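/- Let λ be a Lévy measure on (0,∞). For every r > 0, the following identities hold in [0,∞]: τ̄(r) = ∫_{(0,∞)} min((2πκ)^{-1} (z/r)^{2/d}, t) λ(dz) = r^{-2/d} (2πκ)^{-1} M_{2/d}(rD) + t λ̄(rD) = (πκd)^{-1} r^{-2/d} ∫_0^{rD} u^{2/d − 1} λ̄(u) du. -/

import Mathlib

open MeasureTheory Real Filter Set
open scoped ENNReal Topology

noncomputable section

/-- The heat kernel on `ℝ^d` with diffusion constant `κ`. -/
def heatKernel (d : ℕ) (κ : ℝ) (s : ℝ) (x : EuclideanSpace ℝ (Fin d)) : ℝ :=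
  (2 * π * κ * s) ^ (-(d : ℝ) / 2) * Real.exp (-‖x‖ ^ 2 / (2 * κ * s))

/-- A Lévy measure on `(0,∞)`: a nonzero Borel measure carried by `(0,∞)`
with `∫ min(1, z²) λ(dz) < ∞`. -/
def IsLevyMeasure (lam : Measure ℝ) : Prop :=
  lam ≠ 0 ∧ lam (Set.Iic 0) = 0 ∧
    ∫⁻ z in Set.Ioi (0 : ℝ), ENNReal.ofReal (min 1 (z ^ 2)) ∂lam < ⊤

/-- `η̄(r) = (Leb ⊗ Leb ⊗ λ)({(s,y,z) ∈ (0,t] × ℝ^d × (0,∞) : g(s,y) z > r})`. -/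
def etaBar (d : ℕ) (κ t : ℝ) (lam : Measure ℝ) (r : ℝ) : ℝ≥0∞ :=
  (volume.prod (volume.prod lam))
    {p : ℝ × (EuclideanSpace ℝ (Fin d)) × ℝ |
      p.1 ∈ Set.Ioc (0 : ℝ) t ∧ p.2.2 ∈ Set.Ioi (0 : ℝ) ∧
        r < heatKernel d κ p.1 p.2.1 * p.2.2}

/-- `η̄₀(r)`, the analogue of `η̄` with the restriction `|y| ≤ 1/2`. -/
def etaBar0 (d : ℕ) (κ t : ℝ) (lam : Measure ℝ) (r : ℝ) : ℝ≥0∞ :=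
  (volume.prod (volume.prod lam))
    {p : ℝ × (EuclideanSpace ℝ (Fin d)) × ℝ |
      p.1 ∈ Set.Ioc (0 : ℝ) t ∧ p.2.2 ∈ Set.Ioi (0 : ℝ) ∧ ‖p.2.1‖ ≤ 1 / 2 ∧
        r < heatKernel d κ p.1 p.2.1 * p.2.2}

/-- `η̄_A(r)`, where the heat kernel is evaluated at `dist(y, A)`. -/
def etaBarA (d : ℕ) (κ t : ℝ) (lam : Measure ℝ)
    (A : Set (EuclideanSpace ℝ (Fin d))) (r : ℝ) : ℝ≥0∞ :=
  (volume.prod (volume.prod lam))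
    {p : ℝ × (EuclideanSpace ℝ (Fin d)) × ℝ |
      p.1 ∈ Set.Ioc (0 : ℝ) t ∧ p.2.2 ∈ Set.Ioi (0 : ℝ) ∧
        r < (2 * π * κ * p.1) ^ (-(d : ℝ) / 2) *
            Real.exp (-(Metric.infDist p.2.1 A) ^ 2 / (2 * κ * p.1)) * p.2.2}

/-- `τ̄(r) = (Leb ⊗ λ)({(s,z) ∈ (0,t] × (0,∞) : (2πκs)^{-d/2} z > r})`. -/
def tauBar (d : ℕ) (κ t : ℝ) (lam : Measure ℝ) (r : ℝ) : ℝ≥0∞ :=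
  (volume.prod lam)
    {p : ℝ × ℝ | p.1 ∈ Set.Ioc (0 : ℝ) t ∧ p.2 ∈ Set.Ioi (0 : ℝ) ∧
      r < (2 * π * κ * p.1) ^ (-(d : ℝ) / 2) * p.2}

/-- The truncated moment `M_γ(x) = ∫_{(0,x]} z^γ λ(dz)`. -/
def Mgamma (lam : Measure ℝ) (γ x : ℝ) : ℝ≥0∞ :=
  ∫⁻ z in Set.Ioc (0 : ℝ) x, ENNReal.ofReal (z ^ γ) ∂lam

/-- A measurable function, positive on `[1,∞)`, is slowly varying at infinity if
`ℓ(cx)/ℓ(x) → 1` as `x → ∞` for every `c > 0`. -/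
def SlowlyVarying (ℓ : ℝ → ℝ) : Prop :=
  Measurable ℓ ∧ (∀ x ≥ (1 : ℝ), 0 < ℓ x) ∧
    ∀ c > (0 : ℝ), Tendsto (fun x => ℓ (c * x) / ℓ x) atTop (𝓝 1)

/-- Regular variation at infinity with index `-α`: `f` is eventually positive and
`f(cr)/f(r) → c^{-α}` as `r → ∞` for every `c > 0`. -/
def RegVaryNeg (f : ℝ → ℝ) (α : ℝ) : Prop :=
  (∀ᶠ r in atTop, 0 < f r) ∧
    ∀ c > (0 : ℝ), Tendsto (fun r => f (c * r) / f r) atTop (𝓝 (c ^ (-α)))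

/-- Condition (E): the necessary and sufficient condition for existence of the solution. -/
def ConditionE (d : ℕ) (lam : Measure ℝ) : Prop :=
  (∫⁻ z in Set.Ioi (1 : ℝ), ENNReal.ofReal (Real.log z ^ ((d : ℝ) / 2)) ∂lam < ⊤) ∧
  (d = 1 → ∫⁻ z in Set.Ioc (0 : ℝ) 1, ENNReal.ofReal (z ^ 2) ∂lam < ⊤) ∧
  (d = 2 → ∫⁻ z in Set.Ioc (0 : ℝ) 1, ENNReal.ofReal (z ^ 2 * |Real.log z|) ∂lam < ⊤) ∧
  (3 ≤ d → ∫⁻ z in Set.Ioc (0 : ℝ) 1, ENNReal.ofReal (z ^ (1 + 2 / (d : ℝ))) ∂lam < ⊤)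

/-- Condition (F): `∫_{(0,1)} z^{2/d} λ(dz) < ∞` if `d ≠ 2`,
and `∫_{(0,1)} z |log z| λ(dz) < ∞` if `d = 2`. -/
def ConditionF (d : ℕ) (lam : Measure ℝ) : Prop :=
  (d ≠ 2 → ∫⁻ z in Set.Ioo (0 : ℝ) 1, ENNReal.ofReal (z ^ ((2 : ℝ) / d)) ∂lam < ⊤) ∧
  (d = 2 → ∫⁻ z in Set.Ioo (0 : ℝ) 1, ENNReal.ofReal (z * |Real.log z|) ∂lam < ⊤)

theorem sigmaFinite_of_isLevyMeasure {lam : Measure ℝ} (h : IsLevyMeasure lam) :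
    SigmaFinite lam := by
  obtain ⟨-, h0, hint⟩ := h
  have hfin : ∀ ε : ℝ, 0 < ε → lam (Set.Ioi ε) < ⊤ := by
    intro ε hε
    have hpos : 0 < min 1 (ε ^ 2) := by positivity
    have hle : ENNReal.ofReal (min 1 (ε ^ 2)) * lam (Set.Ioi ε) ≤
        ∫⁻ z in Set.Ioi (0 : ℝ), ENNReal.ofReal (min 1 (z ^ 2)) ∂lam := by
      rw [← setLIntegral_const]
      refine (setLIntegral_mono (by fun_prop) fun z hz => ?_).trans
        (lintegral_mono_set (Set.Ioi_subset_Ioi hε.le))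
      have hz : ε < z := hz
      gcongr
    refine ENNReal.lt_top_of_mul_ne_top_right (hle.trans_lt hint).ne ?_
    exact (ENNReal.ofReal_pos.2 hpos).ne'
  refine Measure.sigmaFinite_of_countable
    (S := insert (Set.Iic 0) (Set.range fun n : ℕ => Set.Ioi (1 / ((n : ℝ) + 1))))
    ((Set.countable_range _).insert _) ?_ ?_
  · rintro s (rfl | ⟨n, rfl⟩)
    · simp [h0]
    · exact hfin _ (by positivity)
  · refine Set.eq_univ_of_forall fun x => ?_
    rcases le_or_gt x 0 with hx | hx
    · exact ⟨_, Set.mem_insert _ _, hx⟩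
    · obtain ⟨n, hn⟩ := exists_nat_one_div_lt hx
      exact ⟨_, Set.mem_insert_of_mem _ ⟨n, rfl⟩, hn⟩

theorem lt_rpow_neg_mul_iff {d : ℕ} (hd : 1 ≤ d) {a s r z : ℝ} (ha : 0 < a) (hs : 0 < s)
    (hr : 0 < r) (hz : 0 < z) :
    r < (a * s) ^ (-(d : ℝ) / 2) * z ↔ s < a⁻¹ * (z / r) ^ ((2 : ℝ) / d) := by
  have hd' : (0 : ℝ) < d := by exact_mod_cast hd
  have has : 0 < a * s := by positivity
  have hX : 0 < (a * s) ^ ((d : ℝ) / 2) := by positivity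
  have hroot : ((z / r) ^ ((2 : ℝ) / d)) ^ ((d : ℝ) / 2) = z / r := by
    rw [← Real.rpow_mul (by positivity)]
    rw [show (2 : ℝ) / d * (d / 2) = 1 by field_simp, Real.rpow_one]
  rw [neg_div, Real.rpow_neg has.le, inv_mul_eq_div, lt_div_iff₀ hX, mul_comm r,
    ← lt_div_iff₀ hr, inv_mul_eq_div, lt_div_iff₀ ha, mul_comm s]
  nth_rewrite 1 [← hroot]
  exact Real.rpow_lt_rpow_iff has.le (by positivity) (by positivity)

theorem volume_Ioc_inter_Iio (c t : ℝ) :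
    volume (Set.Ioc 0 t ∩ Set.Iio c) = ENNReal.ofReal (min c t) := by
  refine le_antisymm ?_ ?_
  · refine (measure_mono (t := Set.Ioc 0 (min c t)) ?_).trans (by simp)
    rintro s ⟨⟨h0, ht⟩, hc⟩
    exact ⟨h0, le_min (le_of_lt hc) ht⟩
  · refine le_trans (by simp) (measure_mono (s := Set.Ioo 0 (min c t)) ?_)
    rintro s ⟨h0, hs⟩
    exact ⟨⟨h0, (hs.trans_le (min_le_right _ _)).le⟩, hs.trans_le (min_le_left _ _)⟩

theorem tauBar_eq_lintegral_min {d : ℕ} (hd : 1 ≤ d) {κ : ℝ} (t : ℝ) (hκ : 0 < κ)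
    (lam : Measure ℝ) [SFinite lam] {r : ℝ} (hr : 0 < r) :
    tauBar d κ t lam r = ∫⁻ z in Set.Ioi (0 : ℝ),
      ENNReal.ofReal (min ((2 * π * κ)⁻¹ * (z / r) ^ ((2 : ℝ) / d)) t) ∂lam := by
  have hmeas : MeasurableSet {p : ℝ × ℝ | p.1 ∈ Set.Ioc (0 : ℝ) t ∧ p.2 ∈ Set.Ioi (0 : ℝ) ∧
      r < (2 * π * κ * p.1) ^ (-(d : ℝ) / 2) * p.2} := by
    have hlt : MeasurableSet {p : ℝ × ℝ | r < (2 * π * κ * p.1) ^ (-(d : ℝ) / 2) * p.2} :=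
      measurableSet_lt measurable_const (by fun_prop)
    exact (measurable_fst measurableSet_Ioc).inter ((measurable_snd measurableSet_Ioi).inter hlt)
  rw [tauBar, Measure.prod_apply_symm hmeas, ← lintegral_indicator measurableSet_Ioi]
  refine lintegral_congr fun z => ?_
  by_cases hz : z ∈ Set.Ioi (0 : ℝ)
  · rw [Set.indicator_of_mem hz, ← volume_Ioc_inter_Iio]
    congr 1
    ext s
    have hiff (hs : 0 < s) := lt_rpow_neg_mul_iff hd (a := 2 * π * κ) (by positivity) hs hr hz
    simp only [Set.mem_preimage, Set.mem_ofPred_eq, Set.mem_inter_iff, Set.mem_Iio]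
    exact ⟨fun h => ⟨h.1, (hiff h.1.1).1 h.2.2⟩, fun h => ⟨h.1, hz, (hiff h.1.1).2 h.2⟩⟩
  · rw [Set.indicator_of_notMem hz]
    simp [show ¬ 0 < z from hz]

/-- The integral of a truncated power in terms of the tail of the measure. -/
theorem lintegral_min_rpow_eq_lintegral_tail (lam : Measure ℝ) {p R : ℝ} (hp : 0 < p)
    (hR : 0 ≤ R) :
    ∫⁻ z in Set.Ioi (0 : ℝ), ENNReal.ofReal (min z R ^ p) ∂lam =
      ENNReal.ofReal p * ∫⁻ u in Set.Ioc (0 : ℝ) R,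
        ENNReal.ofReal (u ^ (p - 1)) * lam (Set.Ioi u) := by
  have hnn : 0 ≤ᵐ[lam.restrict (Set.Ioi 0)] fun z => min z R := by
    filter_upwards [ae_restrict_mem measurableSet_Ioi] with z hz
    exact le_min (le_of_lt hz) hR
  rw [lintegral_rpow_eq_lintegral_meas_lt_mul _ hnn (by fun_prop) hp]
  congr 1
  rw [setLIntegral_congr Ioo_ae_eq_Ioc.symm, ← Set.Ioi_inter_Iio, Set.inter_comm,
    ← setLIntegral_indicator measurableSet_Iio]
  refine setLIntegral_congr_fun measurableSet_Ioi fun u hu => ?_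
  have hu : 0 < u := hu
  by_cases huR : u < R
  · have hset : {z : ℝ | u < min z R} = Set.Ioi u := by
      ext z
      simp [huR]
    simp only [Set.indicator_of_mem (show u ∈ Set.Iio R from huR), hset]
    rw [Measure.restrict_apply measurableSet_Ioi,
      Set.inter_eq_left.2 (Set.Ioi_subset_Ioi hu.le), mul_comm]
  · simp [huR]

theorem mul_div_rpow_min {c r t z R p : ℝ} (hc : 0 ≤ c) (hr : 0 < r) (hz : 0 ≤ z)
    (hR : 0 ≤ R) (hp : 0 ≤ p) (ht : c * (R / r) ^ p = t) :
    min (c * (z / r) ^ p) t = r ^ (-p) * c * min z R ^ p := by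
  have hscale {x : ℝ} (hx : 0 ≤ x) : c * (x / r) ^ p = r ^ (-p) * c * x ^ p := by
    rw [Real.div_rpow hx hr.le, Real.rpow_neg hr.le]
    ring
  have hmono {x y : ℝ} (hx : 0 ≤ x) (hxy : x ≤ y) : c * (x / r) ^ p ≤ c * (y / r) ^ p := by
    gcongr
  subst ht
  rcases le_total z R with h | h
  · rw [min_eq_left h, min_eq_left (hmono hz h), hscale hz]
  · rw [min_eq_right h, min_eq_right (hmono hR h), hscale hR]

/-- Equation (3.4): for `r > 0`, the identities
`τ̄(r) = ∫ min((2πκ)^{-1}(z/r)^{2/d}, t) λ(dz)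
      = r^{-2/d}(2πκ)^{-1} M_{2/d}(rD) + t λ̄(rD)
      = (πκd)^{-1} r^{-2/d} ∫_0^{rD} u^{2/d-1} λ̄(u) du` hold in `[0,∞]`. -/
theorem stmt_9 (d : ℕ) (hd : 1 ≤ d) (κ t : ℝ) (hκ : 0 < κ) (ht : 0 < t)
    (lam : Measure ℝ) (hlam : IsLevyMeasure lam)
    (D : ℝ) (hD : D = (2 * π * κ * t) ^ ((d : ℝ) / 2))
    (r : ℝ) (hr : 0 < r) :
    tauBar d κ t lam r =
        (∫⁻ z in Set.Ioi (0 : ℝ),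
          ENNReal.ofReal (min ((2 * π * κ)⁻¹ * (z / r) ^ ((2 : ℝ) / d)) t) ∂lam) ∧
    tauBar d κ t lam r =
        ENNReal.ofReal (r ^ (-((2 : ℝ) / d)) * (2 * π * κ)⁻¹) *
            Mgamma lam ((2 : ℝ) / d) (r * D) +
          ENNReal.ofReal t * lam (Set.Ioi (r * D)) ∧
    tauBar d κ t lam r =
        ENNReal.ofReal ((π * κ * d)⁻¹ * r ^ (-((2 : ℝ) / d))) *
          ∫⁻ u in Set.Ioc (0 : ℝ) (r * D),
            ENNReal.ofReal (u ^ ((2 : ℝ) / d - 1)) * lam (Set.Ioi u) := by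
  have := sigmaFinite_of_isLevyMeasure hlam
  have hd' : (0 : ℝ) < d := by exact_mod_cast hd
  have hDpos : 0 < D := by rw [hD]; positivity
  have hR : 0 ≤ r * D := by positivity
  have hp : 0 < (2 : ℝ) / d := by positivity
  have hDt : (2 * π * κ)⁻¹ * (r * D / r) ^ ((2 : ℝ) / d) = t := by
    rw [mul_div_cancel_left₀ _ hr.ne', hD, ← Real.rpow_mul (by positivity),
      show (d : ℝ) / 2 * (2 / d) = 1 by field_simp, Real.rpow_one]
    field_simp
  have hmin {z : ℝ} (hz : 0 ≤ z) :=
    mul_div_rpow_min (c := (2 * π * κ)⁻¹) (by positivity) hr hz hR hp.le hDt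
  have hC : 0 ≤ r ^ (-((2 : ℝ) / d)) * (2 * π * κ)⁻¹ := by positivity
  have hτ := tauBar_eq_lintegral_min hd t hκ lam hr
  refine ⟨hτ, ?_, ?_⟩
  · rw [hτ, ← Set.Ioc_union_Ioi_eq_Ioi hR,
      lintegral_union measurableSet_Ioi (Set.Ioc_disjoint_Ioi le_rfl), Mgamma,
      ← lintegral_const_mul _ (by fun_prop), ← setLIntegral_const]
    congr 1
    · refine setLIntegral_congr_fun measurableSet_Ioc fun z hz => ?_
      rw [hmin hz.1.le, min_eq_left hz.2, ENNReal.ofReal_mul hC]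
    · refine setLIntegral_congr_fun measurableSet_Ioi fun z hz => ?_
      have hz : r * D < z := hz
      rw [hmin (hR.trans hz.le), min_eq_right hz.le]
      have hend := hmin hR
      rw [hDt, min_self, min_self] at hend
      rw [← hend]
  · have hconst : (π * κ * d)⁻¹ * r ^ (-((2 : ℝ) / d)) =
        r ^ (-((2 : ℝ) / d)) * (2 * π * κ)⁻¹ * (2 / d) := by
      field_simp
    rw [hτ, hconst, ENNReal.ofReal_mul hC, mul_assoc (ENNReal.ofReal _),
      ← lintegral_min_rpow_eq_lintegral_tail lam hp hR,
      ← lintegral_const_mul _ (by fun_prop)]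
    refine setLIntegral_congr_fun measurableSet_Ioi fun z hz => ?_
    rw [hmin (le_of_lt hz), ENNReal.ofReal_mul hC]

end
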